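/- Fix reals α, β > 1 and (j,k) ∈ ℤ₊². If a bounded measurable set A ⊆ D is bounded away from the closure of F(D_{<j,k} ∪ D_{j,k}) in (D,d), then the preimage F⁻¹(A) is bounded away from D_{<j,k} ∪ D_{j,k}. -/

import Mathlib

open Set Filter Topology MeasureTheory
open scoped ENNReal NNReal

noncomputable section

/-- `f : ℝ → ℝ` is càdlàg on `[0,1]`: right-continuous on `[0,1)` and
with left limits at every point of `(0,1]`. -/
def IsCadlag (f : ℝ → ℝ) : Prop :=
  (∀ t ∈ Set.Ico (0:ℝ) 1, Filter.Tendsto f (nhdsWithin t (Set.Ici t)) (nhds (f t))) ∧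
  (∀ t ∈ Set.Ioc (0:ℝ) 1, ∃ L : ℝ, Filter.Tendsto f (nhdsWithin t (Set.Iio t)) (nhds L))

/-- The projection of `ℝ` onto `[0,1]`. -/
def projI (t : ℝ) : ℝ := max 0 (min 1 t)

/-- Canonical representation of elements of the Skorokhod space `D([0,1])`:
càdlàg on `[0,1]` and determined by the values on `[0,1]`. -/
def MemD (f : ℝ → ℝ) : Prop := IsCadlag f ∧ ∀ t : ℝ, f t = f (projI t)

/-- An increasing homeomorphism of `[0,1]` onto itself. -/
def IsTimeChange (l : ℝ → ℝ) : Prop :=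
  StrictMonoOn l (Set.Icc 0 1) ∧ ContinuousOn l (Set.Icc 0 1) ∧
    Set.MapsTo l (Set.Icc 0 1) (Set.Icc 0 1) ∧ l 0 = 0 ∧ l 1 = 1

/-- The Skorokhod `J1` distance on paths over `[0,1]`. -/
def J1dist (x y : ℝ → ℝ) : ℝ :=
  sInf { r : ℝ | ∃ l : ℝ → ℝ, IsTimeChange l ∧
    r = max (⨆ t : Set.Icc (0:ℝ) 1, |l t - (t : ℝ)|)
            (⨆ t : Set.Icc (0:ℝ) 1, |x (l t) - y t|) }

/-- The Skorokhod space `D = D([0,1])`. -/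
def DD : Type := { f : ℝ → ℝ // MemD f }

/-- The `J1` topology on `D`, generated by the `J1` balls. -/
instance : TopologicalSpace DD :=
  TopologicalSpace.generateFrom
    { S : Set DD | ∃ (x : DD) (ε : ℝ), 0 < ε ∧ S = { y : DD | J1dist x.1 y.1 < ε } }

/-- The Borel σ-algebra on `D`. -/
instance : MeasurableSpace DD := borel DD

/-- The zero path. -/
def zeroPath : DD :=
  ⟨fun _ => 0, ⟨fun _ _ => tendsto_const_nhds, fun _ _ => ⟨0, tendsto_const_nhds⟩⟩, fun _ => rfl⟩

/-- `f` solves the ODE `f t = ∫_0^t b (f s) ds + g t` on `[0,1]`. -/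
def SolvesODE (b : ℝ → ℝ) (g f : ℝ → ℝ) : Prop :=
  ∀ t ∈ Set.Icc (0:ℝ) 1, f t = (∫ s in (0:ℝ)..t, b (f s)) + g t

/-- `A` is bounded away from `B`. -/
def BoundedAway (A B : Set DD) : Prop :=
  ∃ ε : ℝ, 0 < ε ∧ ∀ x ∈ A, ∀ y ∈ B, ε ≤ J1dist x.1 y.1

/-- `A` is a bounded subset of `D`. -/
def BoundedSet (A : Set DD) : Prop :=
  ∃ M : ℝ, ∀ x ∈ A, J1dist x.1 zeroPath.1 ≤ M

/-- `D_{l,m}`: step functions vanishing at the origin with exactly `l` upward jumps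
and `m` downward jumps. -/
def Dlm (l m : ℕ) : Set DD :=
  { f : DD | ∃ (u : Fin l → ℝ) (x : Fin l → ℝ) (v : Fin m → ℝ) (y : Fin m → ℝ),
      Function.Injective u ∧ Function.Injective v ∧ (∀ i j, u i ≠ v j) ∧
      (∀ i, u i ∈ Set.Ioc (0:ℝ) 1) ∧ (∀ i, 0 < x i) ∧
      (∀ j, v j ∈ Set.Ioc (0:ℝ) 1) ∧ (∀ j, 0 < y j) ∧
      ∀ t : ℝ, f.1 t = (∑ i, if u i ≤ projI t then x i else 0)
                     - (∑ j, if v j ≤ projI t then y j else 0) }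

/-- `𝓘(j,k) = (α-1) j + (β-1) k`. -/
def Ical (α β : ℝ) (p : ℕ × ℕ) : ℝ := (α - 1) * p.1 + (β - 1) * p.2

/-- `D_{<j,k}`. -/
def Dlt (α β : ℝ) (j k : ℕ) : Set DD :=
  ⋃ (p : ℕ × ℕ) (_ : p ≠ (j, k) ∧ Ical α β p ≤ Ical α β (j, k)), Dlm p.1 p.2

/-- The rate function `I`. -/
def Ifun (α β : ℝ) (ξ : DD) : ℝ≥0∞ :=
  ⨅ (p : ℕ × ℕ) (_ : ξ ∈ Dlm p.1 p.2), ENNReal.ofReal (Ical α β p)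

/-- The rate function `Ĩ` (relative to the solution map `F`). -/
def Itilde (α β : ℝ) (F : DD → DD) (ξ : DD) : ℝ≥0∞ :=
  ⨅ (p : ℕ × ℕ) (_ : ∃ η : DD, η ∈ Dlm p.1 p.2 ∧ F η = ξ), ENNReal.ofReal (Ical α β p)

/-- The largest upward and downward jump sizes of a path. -/
def piMap (f : ℝ → ℝ) : ℝ × ℝ :=
  (⨆ t : Set.Ioc (0:ℝ) 1, (f t - Function.leftLim f t),
   ⨆ t : Set.Ioc (0:ℝ) 1, (Function.leftLim f t - f t))

/-- Extended logarithm `ℝ≥0∞ → EReal`, with `elog 0 = ⊥` and `elog ⊤ = ⊤`. -/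
def elog (x : ℝ≥0∞) : EReal :=
  if x = 0 then ⊥ else if x = ⊤ then ⊤ else ((Real.log x.toReal : ℝ) : EReal)

end

lemma MemD.tendsto_nhdsGE {f : ℝ → ℝ} (hf : MemD f) (t : ℝ) :
    Tendsto f (𝓝[≥] t) (𝓝 (f t)) := by
  rcases lt_or_ge t 0 with h0 | h0
  · refine tendsto_const_nhds.congr' ?_
    filter_upwards [mem_nhdsWithin_of_mem_nhds (Iio_mem_nhds h0)] with s hs
    rw [hf.2 t, hf.2 s]
    simp [projI, h0.le, (mem_Iio.1 hs).le]
  rcases lt_or_ge t 1 with h1 | h1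
  · exact hf.1.1 t ⟨h0, h1⟩
  · refine tendsto_const_nhds.congr' ?_
    filter_upwards [self_mem_nhdsWithin] with s hs
    rw [hf.2 t, hf.2 s]
    simp [projI, h1, h1.trans (mem_Ici.1 hs)]

lemma MemD.exists_tendsto_nhdsLT {f : ℝ → ℝ} (hf : MemD f) (t : ℝ) :
    ∃ L, Tendsto f (𝓝[<] t) (𝓝 L) := by
  rcases le_or_gt t 0 with h0 | h0
  · refine ⟨f 0, tendsto_const_nhds.congr' ?_⟩
    filter_upwards [self_mem_nhdsWithin] with s hs
    rw [hf.2 0, hf.2 s]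
    simp [projI, (mem_Iio.1 hs).le.trans h0]
  rcases le_or_gt t 1 with h1 | h1
  · exact hf.1.2 t ⟨h0, h1⟩
  · refine ⟨f 1, tendsto_const_nhds.congr' ?_⟩
    filter_upwards [mem_nhdsWithin_of_mem_nhds (Ioi_mem_nhds h1)] with s hs
    rw [hf.2 1, hf.2 s]
    simp [projI, (mem_Ioi.1 hs).le]

lemma projI_mem (t : ℝ) : projI t ∈ Icc (0 : ℝ) 1 :=
  ⟨le_max_left _ _, max_le zero_le_one (min_le_left _ _)⟩

lemma projI_of_mem {t : ℝ} (ht : t ∈ Icc (0 : ℝ) 1) : projI t = t := by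
  simp [projI, ht.1, ht.2]

lemma MemD.exists_bound {f : ℝ → ℝ} (hf : MemD f) : ∃ B, ∀ t, |f t| ≤ B := by
  obtain ⟨B, hB⟩ : ∃ B, ∀ t ∈ Icc (0 : ℝ) 1, |f t| ≤ B := by
    refine isCompact_Icc.induction_on (p := fun S => ∃ B, ∀ t ∈ S, |f t| ≤ B) ⟨0, by simp⟩
      ?_ ?_ ?_
    · rintro s t hst ⟨B, hB⟩
      exact ⟨B, fun r hr => hB r (hst hr)⟩
    · rintro s t ⟨B, hB⟩ ⟨B', hB'⟩
      refine ⟨max B B', fun r hr => ?_⟩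
      rcases hr with hr | hr
      · exact (hB r hr).trans (le_max_left _ _)
      · exact (hB' r hr).trans (le_max_right _ _)
    · intro t _
      obtain ⟨L, hL⟩ := hf.exists_tendsto_nhdsLT t
      have h1 := hL.abs.eventually_le_const (lt_add_one |L|)
      have h2 := (hf.tendsto_nhdsGE t).abs.eventually_le_const (lt_add_one |f t|)
      refine ⟨{s | |f s| ≤ max (|L| + 1) (|f t| + 1)}, mem_nhdsWithin_of_mem_nhds ?_, _,
        fun s hs => hs⟩
      rw [← nhdsLT_sup_nhdsGE]
      exact Filter.mem_sup.2 ⟨h1.mono fun s hs => hs.trans (le_max_left _ _),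
        h2.mono fun s hs => hs.trans (le_max_right _ _)⟩
  exact ⟨B, fun t => by rw [hf.2 t]; exact hB _ (projI_mem t)⟩

lemma MemD.measurable {f : ℝ → ℝ} (hf : MemD f) : Measurable f := by
  refine measurable_of_tendsto_metrizable
    (f := fun (n : ℕ) (t : ℝ) => f (((⌊t * (n + 1)⌋ : ℝ) + 1) / (n + 1))) (fun n => ?_) ?_
  · exact (measurable_from_top (f := fun z : ℤ => f (((z : ℝ) + 1) / (n + 1)))).comp
      (Int.measurable_floor.comp (measurable_id.mul_const _))
  · refine tendsto_pi_nhds.2 fun t => (hf.tendsto_nhdsGE t).comp ?_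
    have hlb : ∀ n : ℕ, t ≤ ((⌊t * (n + 1)⌋ : ℝ) + 1) / (n + 1) := fun n => by
      rw [le_div_iff₀ (by positivity)]
      exact (Int.lt_floor_add_one _).le
    refine tendsto_nhdsWithin_iff.2 ⟨?_, Eventually.of_forall hlb⟩
    refine tendsto_of_tendsto_of_tendsto_of_le_of_le tendsto_const_nhds
      (h := fun n : ℕ => t + 1 / ((n : ℝ) + 1)) ?_ hlb fun n => ?_
    · simpa using (tendsto_const_nhds (x := t)).add tendsto_one_div_add_atTop_nhds_zero_nat
    · have : (0 : ℝ) < n + 1 := by positivity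
      have h := Int.floor_le (t * ((n : ℝ) + 1))
      simp only
      rw [div_le_iff₀ this, add_mul, one_div_mul_cancel this.ne']
      linarith

lemma exists_timeChange_of_J1dist_lt {x y : ℝ → ℝ} (hx : MemD x) (hy : MemD y) {δ : ℝ}
    (h : J1dist x y < δ) : ∃ l, IsTimeChange l ∧
      ∀ t ∈ Icc (0 : ℝ) 1, |l t - t| ≤ δ ∧ |x (l t) - y t| ≤ δ := by
  rw [J1dist] at h
  obtain ⟨r, ⟨l, hl, rfl⟩, hr⟩ := exists_lt_of_csInf_lt
    (by exact ⟨_, id, ⟨strictMono_id.strictMonoOn _, continuousOn_id, mapsTo_id _, rfl, rfl⟩, rfl⟩) h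
  obtain ⟨B, hB⟩ := hx.exists_bound
  obtain ⟨B', hB'⟩ := hy.exists_bound
  have b1 : BddAbove (range fun t : Icc (0 : ℝ) 1 => |l t - (t : ℝ)|) := by
    refine ⟨1, ?_⟩
    rintro _ ⟨t, rfl⟩
    have h1 := hl.2.2.1 t.2
    have h2 := t.2
    exact abs_le.2 ⟨by linarith [h1.1, h2.2], by linarith [h1.2, h2.1]⟩
  have b2 : BddAbove (range fun t : Icc (0 : ℝ) 1 => |x (l t) - y t|) := by
    refine ⟨B + B', ?_⟩
    rintro _ ⟨t, rfl⟩
    exact (abs_sub _ _).trans (add_le_add (hB _) (hB' _))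
  refine ⟨l, hl, fun t ht => ⟨?_, ?_⟩⟩
  · exact (le_ciSup b1 ⟨t, ht⟩).trans ((le_max_left _ _).trans hr.le)
  · exact (le_ciSup b2 ⟨t, ht⟩).trans ((le_max_right _ _).trans hr.le)

lemma J1dist_le {x y l : ℝ → ℝ} (hl : IsTimeChange l) {r : ℝ}
    (h : ∀ t ∈ Icc (0 : ℝ) 1, |l t - t| ≤ r ∧ |x (l t) - y t| ≤ r) : J1dist x y ≤ r := by
  have : Nonempty (Icc (0 : ℝ) 1) := ⟨⟨0, by simp⟩⟩
  have hbdd : BddBelow { r : ℝ | ∃ l : ℝ → ℝ, IsTimeChange l ∧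
      r = max (⨆ t : Icc (0:ℝ) 1, |l t - (t : ℝ)|) (⨆ t : Icc (0:ℝ) 1, |x (l t) - y t|) } := by
    refine ⟨0, ?_⟩
    rintro _ ⟨l', _, rfl⟩
    exact (Real.iSup_nonneg fun t => abs_nonneg _).trans (le_max_left _ _)
  refine (csInf_le hbdd ⟨l, hl, rfl⟩).trans (max_le (ciSup_le ?_) (ciSup_le ?_))
  · exact fun t => (h t t.2).1
  · exact fun t => (h t t.2).2

lemma IsTimeChange.surjOn {l : ℝ → ℝ} (hl : IsTimeChange l) :
    SurjOn l (Icc 0 1) (Icc 0 1) := by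
  have := intermediate_value_Icc zero_le_one hl.2.1
  rwa [hl.2.2.2.1, hl.2.2.2.2] at this

/-- The integral form of Grönwall's inequality. -/
lemma le_mul_exp_of_le_add_integral {φ : ℝ → ℝ} (hφ : Continuous φ) (hφ0 : ∀ t, 0 ≤ t → 0 ≤ φ t)
    {a K : ℝ} (hK : 0 < K)
    (h : ∀ t ∈ Icc (0 : ℝ) 1, φ t ≤ a + K * ∫ s in (0 : ℝ)..t, φ s) :
    ∀ t ∈ Icc (0 : ℝ) 1, φ t ≤ a * Real.exp (K * t) := by
  intro t ht
  have hnn : ∀ s, 0 ≤ s → 0 ≤ ∫ r in (0 : ℝ)..s, φ r := fun s hs =>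
    intervalIntegral.integral_nonneg hs fun r hr => hφ0 r hr.1
  have key := norm_le_gronwallBound_of_norm_deriv_right_le
    (f := fun s => ∫ r in (0 : ℝ)..s, φ r) (f' := φ) (δ := 0) (K := K) (ε := a) (a := 0) (b := 1)
    (intervalIntegral.continuous_primitive (fun _ _ => hφ.intervalIntegrable _ _) 0).continuousOn
    (fun s _ => (hφ.integral_hasStrictDerivAt 0 s).hasDerivAt.hasDerivWithinAt)
    (by simp) (fun s hs => by
      rw [Real.norm_of_nonneg (hφ0 s hs.1), Real.norm_of_nonneg (hnn s hs.1)]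
      linarith [h s (Ico_subset_Icc_self hs)]) t ht
  rw [Real.norm_of_nonneg (hnn t ht.1), gronwallBound_of_K_ne_0 hK.ne'] at key
  have := mul_le_mul_of_nonneg_left key hK.le
  calc φ t ≤ a + K * ∫ s in (0 : ℝ)..t, φ s := h t ht
    _ ≤ _ := add_le_add_right this a
    _ = a * Real.exp (K * t) := by field_simp; simp; ring

/-- A step path agrees at `s` and at any `δ`-close point unless `s` is `δ`-close to a jump;
the function `n` counts the jumps which are `δ`-close. -/
lemma exists_jump_count {l m : ℕ} {y : DD} (hy : y ∈ Dlm l m) {δ : ℝ} (hδ : 0 ≤ δ) :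
    ∃ n : ℝ → ℝ, Integrable n ∧ (∀ s, 0 ≤ n s) ∧ ∫ s, n s = (l + m) * (2 * δ) ∧
      ∀ s ∈ Icc (0 : ℝ) 1, ∀ r ∈ Icc (0 : ℝ) 1, |s - r| ≤ δ → y.1 r = y.1 s ∨ 1 ≤ n s := by
  obtain ⟨u, x, v, z, -, -, -, -, -, -, -, hy⟩ := hy
  let I : ℝ → ℝ → ℝ := fun c => (Icc (c - δ) (c + δ)).indicator fun _ => 1
  have hI : ∀ c, Integrable (I c) := fun c =>
    (integrable_indicator_iff measurableSet_Icc).2 (integrableOn_const (by simp))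
  have hI0 : ∀ c s, 0 ≤ I c s := fun c s => indicator_nonneg (fun _ _ => zero_le_one) s
  have hI1 : ∀ c, ∫ s, I c s = 2 * δ := fun c => by
    have : c + δ - (c - δ) = 2 * δ := by ring
    simp only [I]
    rw [integral_indicator_const _ measurableSet_Icc, Real.volume_real_Icc, this]
    simp [hδ]
  have hlocal : ∀ c s r, |s - r| ≤ δ → I c s < 1 → (c ≤ r ↔ c ≤ s) := fun c s r h hc => by
    by_contra hne
    have hs : s ∈ Icc (c - δ) (c + δ) := by
      have := abs_le.1 h
      constructor <;> by_contra! <;> exact hne ⟨fun _ => by linarith, fun _ => by linarith⟩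
    simp [I, indicator_of_mem hs] at hc
  refine ⟨fun s => ∑ i, I (u i) s + ∑ j, I (v j) s,
    (integrable_finsetSum _ fun i _ => hI _).add (integrable_finsetSum _ fun i _ => hI _),
    fun s => add_nonneg (Finset.sum_nonneg fun i _ => hI0 _ _)
      (Finset.sum_nonneg fun i _ => hI0 _ _), ?_, fun s hs r hr h => ?_⟩
  · rw [integral_add (integrable_finsetSum _ fun i _ => hI _)
      (integrable_finsetSum _ fun i _ => hI _), integral_finsetSum _ fun i _ => hI _,
      integral_finsetSum _ fun i _ => hI _]
    simp [hI1]
    ring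
  · by_cases hn : 1 ≤ ∑ i, I (u i) s + ∑ j, I (v j) s
    · exact Or.inr hn
    push Not at hn
    left
    have hu : ∀ i, I (u i) s < 1 := fun i => by
      have h1 := Finset.single_le_sum (f := fun i => I (u i) s) (fun i _ => hI0 (u i) s)
        (Finset.mem_univ i)
      have h2 := Finset.sum_nonneg (s := Finset.univ) fun j _ => hI0 (v j) s
      linarith
    have hv : ∀ j, I (v j) s < 1 := fun j => by
      have h1 := Finset.single_le_sum (f := fun j => I (v j) s) (fun j _ => hI0 (v j) s)
        (Finset.mem_univ j)
      have h2 := Finset.sum_nonneg (s := Finset.univ) fun i _ => hI0 (u i) s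
      linarith
    rw [hy r, hy s, projI_of_mem hs, projI_of_mem hr]
    simp only [hlocal _ s r h (hu _), hlocal _ s r h (hv _)]

/-- If `y` is a step path with at most `N` jumps, then the solution map is Lipschitz at `y`,
with a constant depending only on `N` and the bounds on `b`. -/
lemma J1dist_solution_le {b : ℝ → ℝ} {C : ℝ} (hC : ∀ x, |b x| ≤ C) {K : ℝ} (hK : 0 < K)
    (hb : ∀ x y, |b x - b y| ≤ K * |x - y|) {x y f g : DD}
    (hf : SolvesODE b x.1 f.1) (hg : SolvesODE b y.1 g.1) {l m : ℕ} (hy : y ∈ Dlm l m)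
    {N : ℝ} (hN : (l + m : ℝ) ≤ N) {δ : ℝ} (hδ : 0 ≤ δ) (hxy : J1dist x.1 y.1 < δ) :
    J1dist f.1 g.1 ≤ (C + (K + 2 * C * (N * 2)) * Real.exp K + 1) * δ := by
  obtain ⟨τ, hτ, hτd⟩ := exists_timeChange_of_J1dist_lt x.2 y.2 hxy
  obtain ⟨n, hn, hn0, hnint, hny⟩ := exists_jump_count hy hδ
  have hC0 : 0 ≤ C := (abs_nonneg _).trans (hC 0)
  have hN0 : 0 ≤ N := le_trans (by positivity) hN
  have hbm : Measurable b :=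
    (LipschitzWith.of_dist_le_mul (K := ⟨K, hK.le⟩) fun x y => hb x y).continuous.measurable
  have hbddInt : ∀ {φ : ℝ → ℝ} {M : ℝ}, Measurable φ → (∀ s, |φ s| ≤ M) →
      ∀ a c, IntervalIntegrable φ volume a c := fun {φ M} hφ hM a c =>
    (intervalIntegrable_const (c := M)).mono_fun' hφ.aestronglyMeasurable
      (Eventually.of_forall hM)
  have hbf := hbddInt (hbm.comp f.2.measurable) fun s => hC (f.1 s)
  have hbg := hbddInt (hbm.comp g.2.measurable) fun s => hC (g.1 s)
  simp only [Function.comp_def] at hbf hbg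
  set w : ℝ → ℝ := fun s => |b (f.1 s) - b (g.1 s)| with hw
  have hwi : ∀ a c, IntervalIntegrable w volume a c := fun a c => ((hbf a c).sub (hbg a c)).abs
  set φ : ℝ → ℝ := fun t => ∫ s in (0 : ℝ)..t, w s with hφ
  have hφc : Continuous φ := intervalIntegral.continuous_primitive hwi 0
  have hφ0 : ∀ t, 0 ≤ t → 0 ≤ φ t := fun t ht =>
    intervalIntegral.integral_nonneg ht fun s _ => abs_nonneg _
  have hdiff : ∀ t ∈ Icc (0 : ℝ) 1,
      |(∫ s in (0 : ℝ)..t, b (f.1 s)) - ∫ s in (0 : ℝ)..t, b (g.1 s)| ≤ φ t := fun t ht => by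
    rw [← intervalIntegral.integral_sub (hbf _ _) (hbg _ _)]
    exact intervalIntegral.abs_integral_le_integral_abs ht.1
  have hwle : ∀ s ∈ Icc (0 : ℝ) 1, w s ≤ K * φ s + (K * δ + 2 * C * n s) := fun s hs => by
    obtain ⟨r, hr, rfl⟩ := hτ.surjOn hs
    rcases hny _ hs r hr (hτd r hr).1 with h | h
    · have hfg : |f.1 (τ r) - g.1 (τ r)| ≤ φ (τ r) + δ := by
        rw [hf _ hs, hg _ hs, add_sub_add_comm]
        refine (abs_add_le _ _).trans (add_le_add (hdiff _ hs) ?_)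
        rw [← h]
        exact (hτd r hr).2
      have h1 := hb (f.1 (τ r)) (g.1 (τ r))
      have h2 := mul_le_mul_of_nonneg_left hfg hK.le
      have h3 : 0 ≤ 2 * C * n (τ r) := mul_nonneg (by positivity) (hn0 _)
      simp only [hw]
      linarith
    · have h1 : w (τ r) ≤ C + C := (abs_sub _ _).trans (add_le_add (hC _) (hC _))
      have h2 : 0 ≤ K * φ (τ r) := mul_nonneg hK.le (hφ0 _ hs.1)
      have h3 : 0 ≤ K * δ := by positivity
      have h4 := mul_le_mul_of_nonneg_left h (by positivity : 0 ≤ 2 * C)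
      linarith
  have hgron := le_mul_exp_of_le_add_integral hφc hφ0 (a := (K + 2 * C * (N * 2)) * δ) hK
    fun t ht => by
      have hφi : IntervalIntegrable φ volume 0 t := hφc.intervalIntegrable _ _
      have hni : IntervalIntegrable n volume 0 t := hn.intervalIntegrable
      have hnt : ∫ s in (0 : ℝ)..t, n s ≤ N * (2 * δ) := by
        rw [intervalIntegral.integral_of_le ht.1]
        refine (setIntegral_le_integral hn (Eventually.of_forall hn0)).trans ?_
        rw [hnint]
        gcongr
      have hle : φ t ≤ ∫ s in (0 : ℝ)..t, (K * φ s + (K * δ + 2 * C * n s)) :=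
        intervalIntegral.integral_mono_on ht.1 (hwi _ _)
          ((hφi.const_mul K).add (intervalIntegrable_const.add (hni.const_mul _)))
          fun s hs => hwle s ⟨hs.1, hs.2.trans ht.2⟩
      rw [intervalIntegral.integral_add (hφi.const_mul K)
        (intervalIntegrable_const.add (hni.const_mul _)),
        intervalIntegral.integral_add intervalIntegrable_const (hni.const_mul _),
        intervalIntegral.integral_const, intervalIntegral.integral_const_mul,
        intervalIntegral.integral_const_mul, smul_eq_mul, sub_zero] at hle
      have h1 : t * (K * δ) ≤ K * δ := mul_le_of_le_one_left (by positivity) ht.2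
      have h2 := mul_le_mul_of_nonneg_left hnt (by positivity : 0 ≤ 2 * C)
      linarith
  have hexp : ∀ t ∈ Icc (0 : ℝ) 1, φ t ≤ (K + 2 * C * (N * 2)) * Real.exp K * δ := fun t ht => by
    refine (hgron t ht).trans ?_
    have : Real.exp (K * t) ≤ Real.exp K :=
      Real.exp_le_exp.2 (mul_le_of_le_one_right hK.le ht.2)
    calc _ ≤ (K + 2 * C * (N * 2)) * δ * Real.exp K := by gcongr
      _ = _ := by ring
  have hexp0 : 0 ≤ (K + 2 * C * (N * 2)) * Real.exp K := by positivity
  refine J1dist_le hτ fun t ht => ⟨(hτd t ht).1.trans ?_, ?_⟩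
  · exact le_mul_of_one_le_left hδ (by linarith)
  · have hτt := hτ.2.2.1 ht
    have h1 : |∫ s in t..τ t, b (f.1 s)| ≤ C * |τ t - t| := by
      rw [← Real.norm_eq_abs]
      exact intervalIntegral.norm_integral_le_of_norm_le_const fun s _ => hC (f.1 s)
    have h2 := mul_le_mul_of_nonneg_left (hτd t ht).1 hC0
    have hsplit : f.1 (τ t) - g.1 t = (∫ s in t..τ t, b (f.1 s)) +
        ((∫ s in (0 : ℝ)..t, b (f.1 s)) - ∫ s in (0 : ℝ)..t, b (g.1 s)) +
        (x.1 (τ t) - y.1 t) := by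
      rw [hf _ hτt, hg _ ht, ← intervalIntegral.integral_add_adjacent_intervals (hbf 0 t)
        (hbf t (τ t))]
      ring
    rw [hsplit]
    have h3 := abs_add_three (∫ s in t..τ t, b (f.1 s))
      ((∫ s in (0 : ℝ)..t, b (f.1 s)) - ∫ s in (0 : ℝ)..t, b (g.1 s)) (x.1 (τ t) - y.1 t)
    linarith [hdiff t ht, hexp t ht, (hτd t ht).2]

lemma exists_jumps_le {α β : ℝ} (hα : 1 < α) (hβ : 1 < β) (j k : ℕ) :
    ∃ N : ℝ, ∀ y ∈ Dlt α β j k ∪ Dlm j k, ∃ l m : ℕ, y ∈ Dlm l m ∧ (l + m : ℝ) ≤ N := by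
  have hα' : 0 < α - 1 := sub_pos.2 hα
  have hβ' : 0 < β - 1 := sub_pos.2 hβ
  have hle : ∀ p : ℕ × ℕ, Ical α β p ≤ Ical α β (j, k) →
      (p.1 + p.2 : ℝ) ≤ Ical α β (j, k) / (α - 1) + Ical α β (j, k) / (β - 1) := fun p hp => by
    have h1 : 0 ≤ (α - 1) * p.1 := by positivity
    have h2 : 0 ≤ (β - 1) * p.2 := by positivity
    have h3 : (α - 1) * p.1 + (β - 1) * p.2 ≤ Ical α β (j, k) := hp
    refine add_le_add ((le_div_iff₀' hα').2 ?_) ((le_div_iff₀' hβ').2 ?_) <;> linarith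
  refine ⟨Ical α β (j, k) / (α - 1) + Ical α β (j, k) / (β - 1), fun y hy => ?_⟩
  rcases hy with hy | hy
  · simp only [Dlt, mem_iUnion] at hy
    obtain ⟨p, ⟨-, hp⟩, hy⟩ := hy
    exact ⟨p.1, p.2, hy, hle p hp⟩
  · exact ⟨j, k, hy, hle (j, k) le_rfl⟩

/-- If a bounded measurable set `A ⊆ D` is bounded away from the closure of
`F '' (D_{<j,k} ∪ D_{j,k})`, then `F⁻¹(A)` is bounded away from `D_{<j,k} ∪ D_{j,k}`. -/
theorem preimage_boundedAway_Dlt_union_Dlm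
    (α β : ℝ) (hα : 1 < α) (hβ : 1 < β) (j k : ℕ)
    (b : ℝ → ℝ) (hbdd : ∃ C : ℝ, ∀ x : ℝ, |b x| ≤ C)
    (hlip : ∃ K : NNReal, LipschitzWith K b)
    (F : DD → DD) (hF : ∀ g : DD, SolvesODE b g.1 (F g).1)
    (A : Set DD) (hAmeas : MeasurableSet A) (hAbdd : BoundedSet A)
    (haway : BoundedAway A (closure (F '' (Dlt α β j k ∪ Dlm j k)))) :
    BoundedAway (F ⁻¹' A) (Dlt α β j k ∪ Dlm j k) := by
  obtain ⟨C, hC⟩ := hbdd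
  obtain ⟨K, hK⟩ := hlip
  obtain ⟨N, hN⟩ := exists_jumps_le hα hβ j k
  obtain ⟨ε, hε, hA⟩ := haway
  have hb : ∀ x y, |b x - b y| ≤ (K + 1 : ℝ) * |x - y| := fun x y =>
    (hK.dist_le_mul x y).trans (mul_le_mul_of_nonneg_right (by simp) dist_nonneg)
  have hC0 : 0 ≤ C := (abs_nonneg _).trans (hC 0)
  set R : ℝ := C + ((K + 1 : ℝ) + 2 * C * (max N 0 * 2)) * Real.exp (K + 1) + 1
  have hR : 0 < R := by positivity
  refine ⟨ε / (2 * R), by positivity, fun x hx y hy => ?_⟩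
  by_contra! hxy
  obtain ⟨l, m, hy', hlm⟩ := hN y hy
  have h1 := J1dist_solution_le hC (by positivity) hb (hF x) (hF y) hy'
    (hlm.trans (le_max_left N 0)) (by positivity) hxy
  have h2 := hA _ hx _ (subset_closure (mem_image_of_mem F hy))
  have h3 : R * (ε / (2 * R)) = ε / 2 := by field_simp
  linarith
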